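/- For the Gaussian density f and CDF F of N(0, σ²), define for x ∈ ℝ and i = 1, …, m+1: h_i(x) = f(C_i − x) − f(C_{i−1} − x) and H_i(x) = F(C_i − x) − F(C_{i−1} − x), with the conventions f(±∞ − x) = 0, F(−∞ − x) = 0, F(+∞ − x) = 1. Then for every x ∈ ℝ and every i = 2, …, m+1: h_i(x)/H_i(x) < h_{i−1}(x)/H_{i−1}(x). -/

import Mathlib

set_option autoImplicit false

open MeasureTheory ProbabilityTheory Filter Finset Matrix

/-- The density of the Gaussian distribution `N(0, σ²)`. -/
noncomputable def gaussPdf (σ x : ℝ) : ℝ :=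
  (σ * Real.sqrt (2 * Real.pi))⁻¹ * Real.exp (-(x ^ 2) / (2 * σ ^ 2))

/-- The cumulative distribution function of the Gaussian distribution `N(0, σ²)`. -/
noncomputable def gaussCdf (σ x : ℝ) : ℝ := ∫ t in Set.Iic x, gaussPdf σ t

/-- `H i x = F(Cᵢ - x) - F(Cᵢ₋₁ - x)` for `i = 1, …, m+1`, with the conventions
`C₀ = -∞`, `C_{m+1} = +∞` (so `F(C₀ - x) = 0` and `F(C_{m+1} - x) = 1`). -/
noncomputable def Hfun (σ : ℝ) (m : ℕ) (C : ℕ → ℝ) (i : ℕ) (x : ℝ) : ℝ :=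
  if i = 1 then gaussCdf σ (C 1 - x)
  else if i = m + 1 then 1 - gaussCdf σ (C m - x)
  else gaussCdf σ (C i - x) - gaussCdf σ (C (i - 1) - x)

/-- `h i x = f(Cᵢ - x) - f(Cᵢ₋₁ - x)` for `i = 1, …, m+1`, with the conventions
`C₀ = -∞`, `C_{m+1} = +∞` (so `f(C₀ - x) = f(C_{m+1} - x) = 0`). -/
noncomputable def hfun (σ : ℝ) (m : ℕ) (C : ℕ → ℝ) (i : ℕ) (x : ℝ) : ℝ :=
  if i = 1 then gaussPdf σ (C 1 - x)
  else if i = m + 1 then -gaussPdf σ (C m - x)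
  else gaussPdf σ (C i - x) - gaussPdf σ (C (i - 1) - x)

lemma aux_pdf_eq {σ : ℝ} (hσ : 0 < σ) (x : ℝ) :
    gaussPdf σ x = gaussianPDFReal 0 (Real.toNNReal (σ ^ 2)) x := by
  have h : Real.sqrt (2 * Real.pi * σ ^ 2) = σ * Real.sqrt (2 * Real.pi) := by
    rw [Real.sqrt_mul (by positivity), Real.sqrt_sq hσ.le, mul_comm]
  simp only [gaussPdf, gaussianPDFReal, Real.coe_toNNReal _ (sq_nonneg σ), sub_zero]
  rw [h]

lemma aux_pdf_pos {σ : ℝ} (hσ : 0 < σ) (x : ℝ) : 0 < gaussPdf σ x := by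
  unfold gaussPdf
  positivity

lemma aux_cdf_eq {σ : ℝ} (hσ : 0 < σ) (x : ℝ) :
    gaussCdf σ x = cdf (gaussianReal 0 (Real.toNNReal (σ ^ 2))) x := by
  have hv : (Real.toNNReal (σ ^ 2)) ≠ 0 := by
    exact (Real.toNNReal_pos.2 (by positivity)).ne'
  rw [cdf_eq_real, Measure.real, gaussianReal_apply_eq_integral _ hv, ENNReal.toReal_ofReal]
  · simp only [gaussCdf, aux_pdf_eq hσ]
  · exact integral_nonneg fun t => gaussianPDFReal_nonneg _ _ _

lemma aux_pdf_cont (σ : ℝ) : Continuous (gaussPdf σ) := by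
  unfold gaussPdf
  fun_prop

lemma aux_pdf_int {σ : ℝ} (hσ : 0 < σ) : Integrable (gaussPdf σ) := by
  have : gaussPdf σ = gaussianPDFReal 0 (Real.toNNReal (σ ^ 2)) :=
    funext (aux_pdf_eq hσ)
  rw [this]
  exact integrable_gaussianPDFReal _ _

lemma aux_cdf_deriv {σ : ℝ} (hσ : 0 < σ) (x : ℝ) :
    HasDerivAt (gaussCdf σ) (gaussPdf σ x) x := by
  have h : gaussCdf σ = fun y => gaussCdf σ 0 + ∫ t in (0 : ℝ)..y, gaussPdf σ t := by
    funext y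
    have := intervalIntegral.integral_Iic_sub_Iic (μ := volume) (f := gaussPdf σ) (a := 0) (b := y)
      (aux_pdf_int hσ).integrableOn (aux_pdf_int hσ).integrableOn
    unfold gaussCdf
    linarith
  rw [h]
  exact (intervalIntegral.integral_hasDerivAt_right
    ((aux_pdf_cont σ).intervalIntegrable _ _)
    ((aux_pdf_cont σ).stronglyMeasurableAtFilter _ _) (aux_pdf_cont σ).continuousAt).const_add _

lemma aux_pdf_deriv {σ : ℝ} (x : ℝ) :
    HasDerivAt (gaussPdf σ) (-(x / σ ^ 2) * gaussPdf σ x) x := by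
  have h := ((((hasDerivAt_pow 2 x).neg).div_const (2 * σ ^ 2)).exp).const_mul
    ((σ * Real.sqrt (2 * Real.pi))⁻¹)
  refine h.congr_deriv ?_
  simp only [gaussPdf, Pi.neg_apply]
  rw [show -(((2 : ℕ) : ℝ) * x ^ (2 - 1)) / (2 * σ ^ 2) = -(x / σ ^ 2) by
    norm_num
    rw [neg_div, mul_div_mul_left _ _ two_ne_zero]]
  ring

lemma aux_pdf_tendsto {σ : ℝ} (hσ : 0 < σ) {l : Filter ℝ}
    (h : Tendsto (fun x : ℝ => x ^ 2) l atTop) : Tendsto (gaussPdf σ) l (nhds 0) := by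
  have h1 : Tendsto (fun x : ℝ => -(x ^ 2) / (2 * σ ^ 2)) l atBot :=
    (tendsto_neg_atTop_atBot.comp h).atBot_div_const (by positivity)
  have h2 := (Real.tendsto_exp_atBot.comp h1).const_mul ((σ * Real.sqrt (2 * Real.pi))⁻¹)
  rw [mul_zero] at h2
  exact h2

lemma aux_cdf_mono {σ : ℝ} (hσ : 0 < σ) : StrictMono (gaussCdf σ) := by
  apply strictMono_of_deriv_pos
  intro x
  rw [(aux_cdf_deriv hσ x).deriv]
  exact aux_pdf_pos hσ x

lemma aux_cdf_pos {σ : ℝ} (hσ : 0 < σ) (x : ℝ) : 0 < gaussCdf σ x := by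
  have h := aux_cdf_mono hσ (sub_one_lt x)
  have h2 : 0 ≤ gaussCdf σ (x - 1) := by rw [aux_cdf_eq hσ]; exact cdf_nonneg _ _
  linarith

lemma aux_cdf_lt {σ : ℝ} (hσ : 0 < σ) (x : ℝ) : gaussCdf σ x < 1 := by
  have h := aux_cdf_mono hσ (lt_add_one x)
  have h2 : gaussCdf σ (x + 1) ≤ 1 := by rw [aux_cdf_eq hσ]; exact cdf_le_one _ _
  linarith

/-- Auxiliary function with maximum at `c`. -/
noncomputable def auxG (σ c t : ℝ) : ℝ := gaussPdf σ t + (c / σ ^ 2) * gaussCdf σ t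

lemma auxG_deriv {σ : ℝ} (hσ : 0 < σ) (c t : ℝ) :
    HasDerivAt (auxG σ c) ((c - t) / σ ^ 2 * gaussPdf σ t) t := by
  refine ((aux_pdf_deriv t).add ((aux_cdf_deriv hσ t).const_mul (c / σ ^ 2))).congr_deriv ?_
  ring

lemma auxG_cont {σ : ℝ} (hσ : 0 < σ) (c : ℝ) : Continuous (auxG σ c) :=
  continuous_iff_continuousAt.2 fun t => (auxG_deriv hσ c t).continuousAt

lemma auxG_mono {σ : ℝ} (hσ : 0 < σ) (c : ℝ) : StrictMonoOn (auxG σ c) (Set.Iic c) := by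
  apply strictMonoOn_of_deriv_pos (convex_Iic c) (auxG_cont hσ c).continuousOn
  intro t ht
  rw [interior_Iic, Set.mem_Iio] at ht
  rw [(auxG_deriv hσ c t).deriv]
  have := aux_pdf_pos hσ t
  have : 0 < c - t := by linarith
  positivity

lemma auxG_anti {σ : ℝ} (hσ : 0 < σ) (c : ℝ) : StrictAntiOn (auxG σ c) (Set.Ici c) := by
  apply strictAntiOn_of_deriv_neg (convex_Ici c) (auxG_cont hσ c).continuousOn
  intro t ht
  rw [interior_Ici, Set.mem_Ioi] at ht
  rw [(auxG_deriv hσ c t).deriv]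
  have h1 := aux_pdf_pos hσ t
  have h2 : (c - t) / σ ^ 2 < 0 := div_neg_of_neg_of_pos (by linarith) (by positivity)
  exact mul_neg_of_neg_of_pos h2 h1

lemma auxG_pos {σ : ℝ} (hσ : 0 < σ) (c : ℝ) : 0 < auxG σ c c := by
  have h1 : auxG σ c (c - 1) < auxG σ c c :=
    auxG_mono hσ c (by simp) (by simp) (by linarith)
  have hF : Tendsto (gaussCdf σ) atBot (nhds 0) := by
    rw [show gaussCdf σ = _ from funext (aux_cdf_eq hσ)]
    exact tendsto_cdf_atBot _
  have ht : Tendsto (auxG σ c) atBot (nhds 0) := by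
    have hsq : Tendsto (fun x : ℝ => x ^ 2) atBot atTop := by
      have := (tendsto_pow_atTop (α := ℝ) two_ne_zero).comp tendsto_neg_atBot_atTop
      simpa [Function.comp_def] using this
    have := (aux_pdf_tendsto hσ hsq).add (hF.const_mul (c / σ ^ 2))
    simp only [mul_zero, add_zero, mul_one, zero_add] at this
    exact this
  have h2 : 0 ≤ auxG σ c (c - 1) := by
    refine le_of_tendsto ht ?_
    filter_upwards [eventually_le_atBot (c - 1)] with t ht
    exact (auxG_mono hσ c).monotoneOn (by simp; linarith) (by simp) ht
  linarith

lemma auxG_gt {σ : ℝ} (hσ : 0 < σ) (c : ℝ) : c / σ ^ 2 < auxG σ c c := by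
  have h1 : auxG σ c (c + 1) < auxG σ c c :=
    auxG_anti hσ c (by simp) (by simp) (by linarith)
  have hF : Tendsto (gaussCdf σ) atTop (nhds 1) := by
    rw [show gaussCdf σ = _ from funext (aux_cdf_eq hσ)]
    exact tendsto_cdf_atTop _
  have ht : Tendsto (auxG σ c) atTop (nhds (c / σ ^ 2)) := by
    have := (aux_pdf_tendsto hσ (tendsto_pow_atTop two_ne_zero)).add
      (hF.const_mul (c / σ ^ 2))
    simp only [mul_zero, add_zero, mul_one, zero_add] at this
    exact this
  have h2 : c / σ ^ 2 ≤ auxG σ c (c + 1) := by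
    refine le_of_tendsto ht ?_
    filter_upwards [eventually_ge_atTop (c + 1)] with t ht
    exact (auxG_anti hσ c).antitoneOn (by simp) (by simp; linarith) ht
  linarith

/-- the ratios `hᵢ(x)/Hᵢ(x)` are strictly decreasing in `i`. -/
theorem stmt_15 {σ : ℝ} (hσ : 0 < σ) {m : ℕ} (hm : 1 ≤ m)
    (C : ℕ → ℝ) (hC : ∀ i j, 1 ≤ i → i < j → j ≤ m → C i < C j) :
    ∀ x : ℝ, ∀ i : ℕ, 2 ≤ i → i ≤ m + 1 →
      hfun σ m C i x / Hfun σ m C i x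
        < hfun σ m C (i - 1) x / Hfun σ m C (i - 1) x := by
  intro x i hi him
  obtain ⟨k, rfl⟩ : ∃ k, i = k + 1 := ⟨i - 1, by omega⟩
  simp only [Nat.add_sub_cancel]
  have hk1 : 1 ≤ k := by omega
  trans (-((C k - x) / σ ^ 2))
  · by_cases hkm : k = m
    · subst hkm
      have hH : Hfun σ k C (k + 1) x = 1 - gaussCdf σ (C k - x) := by
        simp [Hfun, show k ≠ 0 by omega]
      have hh : hfun σ k C (k + 1) x = - gaussPdf σ (C k - x) := by
        simp [hfun, show k ≠ 0 by omega]
      rw [hH, hh, div_lt_iff₀ (by linarith [aux_cdf_lt hσ (C k - x)])]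
      have := auxG_gt hσ (C k - x)
      unfold auxG at this
      linarith
    · have hlt : C k - x < C (k + 1) - x := by
        linarith [hC k (k + 1) hk1 (by omega) (by omega)]
      have hH : Hfun σ m C (k + 1) x
          = gaussCdf σ (C (k + 1) - x) - gaussCdf σ (C k - x) := by
        simp [Hfun, show k ≠ 0 by omega, hkm]
      have hh : hfun σ m C (k + 1) x
          = gaussPdf σ (C (k + 1) - x) - gaussPdf σ (C k - x) := by
        simp [hfun, show k ≠ 0 by omega, hkm]
      rw [hH, hh, div_lt_iff₀ (by linarith [aux_cdf_mono hσ hlt])]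
      have := auxG_anti hσ (C k - x) Set.self_mem_Ici (Set.mem_Ici.2 hlt.le) hlt
      unfold auxG at this
      linarith
  · by_cases hk : k = 1
    · subst hk
      have hH : Hfun σ m C 1 x = gaussCdf σ (C 1 - x) := by simp [Hfun]
      have hh : hfun σ m C 1 x = gaussPdf σ (C 1 - x) := by simp [hfun]
      rw [hH, hh, lt_div_iff₀ (aux_cdf_pos hσ _)]
      have := auxG_pos hσ (C 1 - x)
      unfold auxG at this
      linarith
    · have hlt : C (k - 1) - x < C k - x := by
        linarith [hC (k - 1) k (by omega) (by omega) (by omega)]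
      have hH : Hfun σ m C k x = gaussCdf σ (C k - x) - gaussCdf σ (C (k - 1) - x) := by
        simp [Hfun, hk, show k ≠ m + 1 by omega]
      have hh : hfun σ m C k x = gaussPdf σ (C k - x) - gaussPdf σ (C (k - 1) - x) := by
        simp [hfun, hk, show k ≠ m + 1 by omega]
      rw [hH, hh, lt_div_iff₀ (by linarith [aux_cdf_mono hσ hlt])]
      have := auxG_mono hσ (C k - x) (Set.mem_Iic.2 hlt.le) Set.self_mem_Iic hlt
      unfold auxG at this
      linarith
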